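/- For partitions λ, μ, ν of n, the number of pairs (α, β) of permutations in S_n with α of cycle type λ, β of cycle type μ, and αβ of a fixed permutation of cycle type ν equals (n!/(z_λ z_μ)) · Σ_{ρ ⊢ n} χ^ρ(λ) χ^ρ(μ) χ^ρ(ν) / χ^ρ(1^n), where the sum runs over all partitions ρ of n. -/

import Mathlib

open Equiv Finset MvPolynomial

/-- `σ` has cycle type `lam` (cycle lengths including fixed points). -/
def hasCycleType {n : ℕ} (σ : Perm (Fin n)) (lam : n.Partition) : Prop :=
  σ.partition.parts = lam.parts

/-- number of pairs `(α, β)` with cycle types `lam`, `mu` and `α * β = σ`. -/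
noncomputable def numFactorizations (n : ℕ) (lam mu : n.Partition) (σ : Perm (Fin n)) : ℕ :=
  Nat.card {p : Perm (Fin n) × Perm (Fin n) //
    hasCycleType p.1 lam ∧ hasCycleType p.2 mu ∧ p.1 * p.2 = σ}

/-- `z_λ = ∏ i, α_i! i^{α_i}`, the order of the centralizer. -/
def zPart {n : ℕ} (lam : n.Partition) : ℕ :=
  ∏ i ∈ Finset.range (n + 1),
    (Nat.factorial (Multiset.count i lam.parts)) * i ^ (Multiset.count i lam.parts)

/-- The irreducible character `χ^ρ` of `S_n` evaluated at class `μ`, via the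
Frobenius character formula: the coefficient of `x^{ρ + δ}` in `a_δ ⬝ p_μ`. -/
noncomputable def charSn (n : ℕ) (ρ μ : n.Partition) : ℤ :=
  MvPolynomial.coeff
    (Finsupp.equivFunOnFinite.symm fun i : Fin n =>
      ((ρ.parts.sort (· ≤ ·)).reverse.getD i 0) + (n - 1 - (i : ℕ)))
    ((∏ i : Fin n, ∏ j ∈ Finset.univ.filter (fun j => i < j),
        (X i - X j : MvPolynomial (Fin n) ℤ)) *
      (μ.parts.map (fun k => ∑ j : Fin n, (X j : MvPolynomial (Fin n) ℤ) ^ k)).prod)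

/-- The hook partition `(n-r, 1^r)` of `n`. -/
def hookPartition (n r : ℕ) (h : r < n) : n.Partition :=
  ⟨(n - r) ::ₘ Multiset.replicate r 1, by
    intro i hi
    rcases Multiset.mem_cons.mp hi with h1 | h1
    · omega
    · simp [Multiset.eq_of_mem_replicate h1],
   by simp [Multiset.sum_replicate]; omega⟩

/-- The partition `1^n` of `n`. -/
def onesPartition (n : ℕ) : n.Partition :=
  ⟨Multiset.replicate n 1, by
    intro i hi
    simp [Multiset.eq_of_mem_replicate hi], by simp⟩

section Characters

open Module

variable {G : Type} [Group G]

/-- A function on `G` is an irreducible character if it is the character of a finite-dimensional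
irreducible complex representation. -/
def IsIrredChar (χ : G → ℂ) : Prop :=
  ∃ (V : Type) (_ : AddCommGroup V) (_ : Module ℂ V) (_ : FiniteDimensional ℂ V)
    (ρ : Representation ℂ G V), ρ.IsIrreducible ∧ χ = ρ.character

theorem Representation.character_eq_add_of_isCompl {V : Type} [AddCommGroup V] [Module ℂ V]
    [FiniteDimensional ℂ V] (ρ : Representation ℂ G V) {W W' : Subrepresentation ρ}
    (h : IsCompl W.toSubmodule W'.toSubmodule) :
    ρ.character = W.toRepresentation.character + W'.toRepresentation.character := by
  funext g
  let N : Bool → Submodule ℂ V := fun b => if b then W.toSubmodule else W'.toSubmodule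
  have hN : DirectSum.IsInternal N :=
    (DirectSum.isInternal_submodule_iff_isCompl N (i := true) (j := false) (by simp)
      (by ext b; cases b <;> simp)).2 (by simpa [N] using h)
  have hf : ∀ b, Set.MapsTo (ρ g) (N b) (N b) := by
    rintro (_ | _)
    · exact W'.apply_mem_toSubmodule g
    · exact W.apply_mem_toSubmodule g
  have key := LinearMap.trace_eq_sum_trace_restrict hN hf
  rw [Fintype.sum_bool] at key
  exact key

theorem Representation.character_mem_span_isIrredChar [Finite G] (d : ℕ) :
    ∀ (V : Type) [AddCommGroup V] [Module ℂ V] [FiniteDimensional ℂ V]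
      (ρ : Representation ℂ G V), finrank ℂ V = d →
      ρ.character ∈ Submodule.span ℤ {χ : G → ℂ | IsIrredChar χ} := by
  induction d using Nat.strong_induction_on with
  | _ d ih =>
  intro V _ _ _ ρ hd
  by_cases h0 : Subsingleton V
  · have : ρ.character = 0 := by
      funext g
      have : ρ g = 0 := by ext v; exact Subsingleton.elim _ _
      simp [Representation.character, this]
    rw [this]
    exact Submodule.zero_mem _
  by_cases hirr : ρ.IsIrreducible
  · exact Submodule.subset_span ⟨V, _, _, inferInstance, ρ, hirr, rfl⟩
  have hnt : Nontrivial V := not_subsingleton_iff_nontrivial.1 h0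
  have hbt : (⊥ : Subrepresentation ρ) ≠ ⊤ := by
    intro h
    have h2 : (⊥ : Submodule ℂ V) = ⊤ := congrArg Subrepresentation.toSubmodule h
    exact bot_ne_top h2
  obtain ⟨W, hWb, hWt⟩ : ∃ W : Subrepresentation ρ, W ≠ ⊥ ∧ W ≠ ⊤ := by
    by_contra! hall
    have : Nontrivial (Subrepresentation ρ) := ⟨⟨⊥, ⊤, hbt⟩⟩
    exact hirr ⟨fun W => or_iff_not_imp_left.2 (hall W)⟩
  obtain ⟨W', hc⟩ := exists_isCompl W
  have hc' : IsCompl W.toSubmodule W'.toSubmodule := by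
    rw [isCompl_iff, disjoint_iff, codisjoint_iff]
    exact ⟨congrArg Subrepresentation.toSubmodule hc.inf_eq_bot,
      congrArg Subrepresentation.toSubmodule hc.sup_eq_top⟩
  have hlt : ∀ U : Subrepresentation ρ, U ≠ ⊤ → finrank ℂ U.toSubmodule < d := by
    intro U hU
    rw [← hd]
    exact Submodule.finrank_lt fun h => hU (Subrepresentation.toSubmodule_injective h)
  have hW't : W' ≠ ⊤ := by
    rintro rfl
    exact hWb (by simpa using hc.inf_eq_bot)
  rw [Representation.character_eq_add_of_isCompl ρ hc']
  exact Submodule.add_mem _ (ih _ (hlt W hWt) _ _ rfl) (ih _ (hlt W' hW't) _ _ rfl)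

open scoped Classical in
theorem IsIrredChar.sum_mul_inv [Fintype G] {χ ψ : G → ℂ} (hχ : IsIrredChar χ)
    (hψ : IsIrredChar ψ) :
    ∑ g, χ g * ψ g⁻¹ = if χ = ψ then (Nat.card G : ℂ) else 0 := by
  obtain ⟨V, _, _, _, ρ, hρ, rfl⟩ := hχ
  obtain ⟨W, _, _, _, τ, hτ, rfl⟩ := hψ
  have hG : (Nat.card G : ℂ) ≠ 0 := Nat.cast_ne_zero.2 Nat.card_pos.ne'
  let : Invertible (Nat.card G : ℂ) := invertibleOfNonzero hG
  have h1 := Representation.char_orthonormal ρ τ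
  have h2 := Representation.char_orthonormal ρ ρ
  rw [if_pos ⟨Representation.Equiv.refl ρ⟩] at h2
  split_ifs with h
  · rw [← h]
    field_simp at h2
    simpa using h2
  · rw [if_neg (fun ⟨e⟩ => h (Representation.char_iso e).symm)] at h1
    simpa [hG] using h1

theorem IsIrredChar.apply_one_ne_zero {χ : G → ℂ} (hχ : IsIrredChar χ) : χ 1 ≠ 0 := by
  obtain ⟨V, _, _, _, ρ, hρ, rfl⟩ := hχ
  have : Nontrivial V := by
    by_contra h
    rw [not_nontrivial_iff_subsingleton] at h
    exact bot_ne_top (α := Subrepresentation ρ)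
      (Subrepresentation.toSubmodule_injective (Subsingleton.elim _ _))
  rw [Representation.char_one]
  exact Nat.cast_ne_zero.2 finrank_pos.ne'

theorem Representation.IsIrreducible.exists_sum_smul_eq_smul_one [Fintype G] {V : Type}
    [AddCommGroup V] [Module ℂ V] [FiniteDimensional ℂ V] {ρ : Representation ℂ G V}
    (hρ : ρ.IsIrreducible) {a : G → ℂ} (ha : ∀ g h, a (h * g * h⁻¹) = a g) :
    ∃ c : ℂ, ∑ g, a g • ρ g = c • (1 : Module.End ℂ V) := by
  have hcomm : ∀ h, (∑ g, a g • ρ g) * ρ h = ρ h * ∑ g, a g • ρ g := by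
    intro h
    rw [Finset.sum_mul, Finset.mul_sum,
      ← Equiv.sum_comp (MulAut.conj h).toEquiv (fun g => a g • ρ g * ρ h)]
    refine Finset.sum_congr rfl fun g _ => ?_
    simp [MulAut.conj_apply, ha, ← map_mul]
  let f : ρ.IntertwiningMap ρ :=
    ⟨∑ g, a g • ρ g, fun h => hcomm h⟩
  obtain ⟨c, hc⟩ := (Representation.IsIrreducible.algebraMap_intertwiningMap_bijective_of_isAlgClosed
    (ρ := ρ)).2 f
  refine ⟨c, ?_⟩
  have := congrArg Representation.IntertwiningMap.toLinearMap hc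
  exact this.symm

/-- Central characters are multiplicative. -/
theorem IsIrredChar.sum_mul_sum [Fintype G] {χ : G → ℂ} (hχ : IsIrredChar χ) {a b : G → ℂ}
    (ha : ∀ g h, a (h * g * h⁻¹) = a g) (hb : ∀ g h, b (h * g * h⁻¹) = b g) :
    (∑ g, a g * χ g) * (∑ g, b g * χ g) = χ 1 * ∑ g, ∑ h, a g * b h * χ (g * h) := by
  obtain ⟨V, _, _, _, ρ, hρ, rfl⟩ := hχ
  obtain ⟨c, hc⟩ := hρ.exists_sum_smul_eq_smul_one ha
  obtain ⟨d, hd⟩ := hρ.exists_sum_smul_eq_smul_one hb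
  have htr : ∀ (a : G → ℂ), ∑ g, a g * ρ.character g = LinearMap.trace ℂ V (∑ g, a g • ρ g) := by
    intro a
    simp [Representation.character]
  have h3 : ∑ g, ∑ h, a g * b h * ρ.character (g * h) =
      LinearMap.trace ℂ V ((∑ g, a g • ρ g) * ∑ g, b g • ρ g) := by
    rw [Finset.sum_mul_sum, map_sum]
    simp [Representation.character, smul_smul, mul_comm, mul_assoc]
  rw [h3, htr, htr, hc, hd]
  simp [Representation.char_one]
  ring

theorem isIrredChar_or_neg_of_mem_span [Fintype G] {f : G → ℂ}
    (hf : f ∈ Submodule.span ℤ {χ : G → ℂ | IsIrredChar χ})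
    (h1 : ∑ g, f g * f g⁻¹ = Nat.card G) : IsIrredChar f ∨ IsIrredChar (-f) := by
  classical
  obtain ⟨c, rfl⟩ := (Finsupp.mem_span_iff_linearCombination _ _ _).1 hf
  have hG : (Nat.card G : ℂ) ≠ 0 := Nat.cast_ne_zero.2 Nat.card_pos.ne'
  have hval : ∀ g, (Finsupp.linearCombination ℤ Subtype.val c : G → ℂ) g =
      ∑ χ ∈ c.support, (c χ : ℂ) * χ.1 g := by
    intro g
    simp [Finsupp.linearCombination_apply, Finsupp.sum, Finset.sum_apply]
    rfl
  have hsq : ∑ χ ∈ c.support, c χ ^ 2 = 1 := by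
    have key : ∑ g, (Finsupp.linearCombination ℤ Subtype.val c : G → ℂ) g *
        (Finsupp.linearCombination ℤ Subtype.val c : G → ℂ) g⁻¹ =
        (∑ χ ∈ c.support, (c χ : ℂ) ^ 2) * Nat.card G := by
      simp_rw [hval, Finset.sum_mul_sum]
      rw [Finset.sum_comm, Finset.sum_mul]
      refine Finset.sum_congr rfl fun χ hχ => ?_
      rw [Finset.sum_comm]
      have : ∀ ψ ∈ c.support, ∑ g, (c χ : ℂ) * χ.1 g * ((c ψ : ℂ) * ψ.1 g⁻¹) =
          if χ = ψ then (c χ : ℂ) ^ 2 * Nat.card G else 0 := by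
        intro ψ _
        have h := χ.2.sum_mul_inv ψ.2
        calc _ = (c χ : ℂ) * c ψ * ∑ g, χ.1 g * ψ.1 g⁻¹ := by
              rw [Finset.mul_sum]; exact Finset.sum_congr rfl fun _ _ => by ring
          _ = _ := by
              rw [h]
              by_cases e : χ = ψ
              · subst e; simp; ring
              · rw [if_neg e, if_neg (fun h => e (Subtype.ext h)), mul_zero]
      rw [Finset.sum_congr rfl this, Finset.sum_ite_eq, if_pos hχ]
    rw [h1] at key
    have h2 : (∑ χ ∈ c.support, (c χ : ℂ) ^ 2) = 1 := by
      apply mul_right_cancel₀ hG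
      rw [← key, one_mul]
    exact_mod_cast h2
  have hne : c.support.Nonempty := by
    by_contra h
    rw [Finset.not_nonempty_iff_eq_empty] at h
    simp [h] at hsq
  obtain ⟨χ, hχ⟩ := hne
  have hpos : ∀ ψ ∈ c.support, 0 < c ψ ^ 2 := fun ψ hψ => by
    have := Finsupp.mem_support_iff.1 hψ
    positivity
  rw [← Finset.add_sum_erase _ _ hχ] at hsq
  have herase : c.support.erase χ = ∅ := by
    by_contra h
    have := Finset.sum_pos (fun ψ hψ => hpos ψ (Finset.mem_of_mem_erase hψ))
      (Finset.nonempty_iff_ne_empty.2 h)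
    have := hpos χ hχ
    omega
  have hsupp : c.support = {χ} := by
    rw [← Finset.insert_erase hχ, herase]; rfl
  rw [herase, Finset.sum_empty, add_zero, sq_eq_one_iff] at hsq
  rcases hsq with h | h
  · left
    have : (Finsupp.linearCombination ℤ Subtype.val c : G → ℂ) = χ.1 := by
      funext g; rw [hval, hsupp]; simp [h]
    rw [this]; exact χ.2
  · right
    have : -(Finsupp.linearCombination ℤ Subtype.val c : G → ℂ) = χ.1 := by
      funext g; rw [Pi.neg_apply, hval, hsupp]; simp [h]
    rw [this]; exact χ.2

end Characters

section Cauchy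

variable {n : ℕ} {R : Type*} [CommRing R]

/-- The Vandermonde product `∏_{i < j} (x i - x j)`. -/
def vandermondeProd (x : Fin n → R) : R :=
  ∏ i, ∏ j ∈ univ.filter (fun j => i < j), (x i - x j)

theorem prod_erase_sub_mul (x : Fin n → R) (i : Fin n) (v w : R) :
    ∏ l ∈ univ.erase i, (v - w * x l) =
      ∑ k : Fin n, (∑ t ∈ powersetCard k (univ.erase i), ∏ l ∈ univ.erase i \ t, -x l) *
        (v ^ (k : ℕ) * w ^ (k.rev : ℕ)) := by
  have hcard : #(univ.erase i) = n - 1 := by simp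
  have hn : n - 1 + 1 = n := Nat.sub_add_cancel (Nat.one_le_of_lt i.2)
  calc ∏ l ∈ univ.erase i, (v - w * x l) = ∏ l ∈ univ.erase i, (v + w * -x l) := by
        refine prod_congr rfl fun _ _ => by ring
    _ = ∑ k ∈ range n, (∑ t ∈ powersetCard k (univ.erase i), ∏ l ∈ univ.erase i \ t, -x l) *
        (v ^ k * w ^ (n - 1 - k)) := by
        rw [prod_add, sum_powerset, hcard, hn]
        refine sum_congr rfl fun k _ => ?_
        rw [sum_mul]
        refine sum_congr rfl fun t ht => ?_
        rw [mem_powersetCard] at ht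
        rw [prod_const, prod_mul_distrib, prod_const, card_sdiff_of_subset ht.1, hcard, ht.2]
        ring
    _ = _ := by
        rw [← Fin.sum_univ_eq_sum_range (fun k =>
          (∑ t ∈ powersetCard k (univ.erase i), ∏ l ∈ univ.erase i \ t, -x l) *
            (v ^ k * w ^ (n - 1 - k)))]
        refine sum_congr rfl fun k _ => ?_
        rw [Fin.val_rev, Nat.sub_sub, add_comm 1]

theorem prod_prod_erase_sub (x : Fin n → R) :
    ∏ i, ∏ l ∈ univ.erase i, (x i - x l) =
      vandermondeProd x * ∏ i, ∏ j ∈ Ioi i, (x j - x i) := by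
  have hswap : ∏ i, ∏ j ∈ Ioi i, (x j - x i) = ∏ i, ∏ j ∈ univ.filter (fun j => j < i),
      (x i - x j) := by
    refine prod_comm' fun i j => ?_
    simp
  rw [hswap, vandermondeProd, ← prod_mul_distrib]
  refine prod_congr rfl fun i _ => ?_
  rw [← prod_union (disjoint_filter.2 fun j _ h h' => lt_asymm h h')]
  refine prod_congr ?_ fun _ _ => rfl
  ext j
  simp only [mem_erase, mem_univ, and_true, mem_union, mem_filter, true_and]
  exact ⟨fun h => (lt_or_gt_of_ne h).symm, fun h => h.elim ne_of_gt ne_of_lt⟩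

theorem det_prod_erase_one_sub [IsDomain R] {x : Fin n → R} (hx : Function.Injective x)
    (y : Fin n → R) :
    (Matrix.of fun i j => ∏ l ∈ univ.erase i, (1 - y j * x l)).det =
      vandermondeProd x * vandermondeProd y := by
  let E : Matrix (Fin n) (Fin n) R := .of fun i k =>
    ∑ t ∈ powersetCard k (univ.erase i), ∏ l ∈ univ.erase i \ t, -x l
  have h1 : E * (Matrix.projVandermonde 1 y).transpose =
      Matrix.of fun i j => ∏ l ∈ univ.erase i, (1 - y j * x l) := by
    ext i j
    rw [Matrix.of_apply, prod_erase_sub_mul, Matrix.mul_apply]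
    rfl
  have h2 : E * (Matrix.projVandermonde x 1).transpose =
      Matrix.diagonal fun i => ∏ l ∈ univ.erase i, (x i - x l) := by
    ext i j
    have : (E * (Matrix.projVandermonde x 1).transpose) i j =
        ∏ l ∈ univ.erase i, (x j - 1 * x l) := by
      rw [prod_erase_sub_mul, Matrix.mul_apply]
      rfl
    rw [this]
    by_cases hij : i = j
    · subst hij; simp
    · rw [Matrix.diagonal_apply_ne _ hij]
      exact prod_eq_zero (i := j) (by simp [Ne.symm hij]) (by simp)
  have h3 : E.det = vandermondeProd x := by
    have h := congrArg Matrix.det h2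
    rw [Matrix.det_mul, Matrix.det_transpose, Matrix.det_diagonal, prod_prod_erase_sub,
      Matrix.det_projVandermonde] at h
    simp only [Pi.one_apply, mul_one] at h
    refine mul_right_cancel₀ ?_ h
    refine prod_ne_zero_iff.2 fun i _ => prod_ne_zero_iff.2 fun j hj => sub_ne_zero.2 fun e => ?_
    exact (mem_Ioi.1 hj).ne' (hx e)
  rw [← h1, Matrix.det_mul, Matrix.det_transpose, h3, Matrix.det_projVandermonde]
  congr 1
  refine prod_congr rfl fun i _ => prod_congr (by ext; simp) fun j _ => by simp

/-- The Cauchy determinant. -/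
theorem det_inv_one_sub_mul [IsDomain R] {x : Fin n → R} (hx : Function.Injective x)
    (y : Fin n → R) {u : Fin n → Fin n → R} (hu : ∀ i j, u i j * (1 - y j * x i) = 1) :
    (Matrix.of u).det = vandermondeProd x * vandermondeProd y * ∏ p : Fin n × Fin n, u p.1 p.2 := by
  have h1 : (Matrix.of fun i j => ∏ l ∈ univ.erase i, (1 - y j * x l)) =
      Matrix.of fun i j => (∏ l, (1 - y j * x l)) * Matrix.of u i j := by
    ext i j
    rw [Matrix.of_apply, Matrix.of_apply, Matrix.of_apply, ← mul_prod_erase univ _ (mem_univ i)]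
    linear_combination -(∏ l ∈ univ.erase i, (1 - y j * x l)) * hu i j
  rw [← det_prod_erase_one_sub hx, h1, Matrix.det_mul_row, Fintype.prod_prod_type_right,
    mul_right_comm, ← prod_mul_distrib]
  rw [prod_congr rfl (g := fun _ => (1 : R))]
  · simp
  · intro j _
    rw [← prod_mul_distrib]
    exact prod_eq_one fun i _ => by rw [mul_comm, hu]

theorem map_vandermondeProd {S : Type*} [CommRing S] (f : R →+* S) (x : Fin n → R) :
    f (vandermondeProd x) = vandermondeProd fun i => f (x i) := by
  simp [vandermondeProd]

theorem vandermondeProd_mul_left (c : R) (x : Fin n → R) :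
    vandermondeProd (fun i => c * x i) =
      c ^ (∑ i : Fin n, (n - 1 - (i : ℕ))) * vandermondeProd x := by
  rw [← prod_pow_eq_pow_sum, vandermondeProd, vandermondeProd, ← prod_mul_distrib]
  refine prod_congr rfl fun i _ => ?_
  simp_rw [← mul_sub]
  rw [prod_mul_distrib, prod_const]
  congr 2
  rw [← Fin.card_Ioi]
  congr 1
  ext; simp

/-- The Cauchy identity in a fixed degree. -/
theorem cauchy_identity [IsDomain R] {x : Fin n → R} (hx : Function.Injective x)
    (y : Fin n → R) (m : ℕ) :
    vandermondeProd x * vandermondeProd y *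
        ∑ l ∈ finsuppAntidiag (univ : Finset (Fin n × Fin n)) m, ∏ p, (x p.1 * y p.2) ^ l p =
      ∑ w : Perm (Fin n), (Perm.sign w : ℤ) •
        ∑ l ∈ finsuppAntidiag (univ : Finset (Fin n)) (m + ∑ i : Fin n, (n - 1 - (i : ℕ))),
          ∏ i, (x (w i) * y i) ^ l i := by
  let u : Fin n → Fin n → PowerSeries R := fun i j => PowerSeries.mk fun k => (x i * y j) ^ k
  have hu : ∀ i j, u i j * (1 - (PowerSeries.X * PowerSeries.C (y j)) * PowerSeries.C (x i)) = 1 := by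
    intro i j
    have : (PowerSeries.X * PowerSeries.C (y j)) * PowerSeries.C (x i) =
        (PowerSeries.X * PowerSeries.C (x i * y j) : PowerSeries R) := by
      rw [map_mul]; ring
    rw [this, mul_sub, mul_one, ← mul_assoc]
    ext k
    rcases k with _ | k
    · simp [u]
    · rw [map_sub, PowerSeries.coeff_mul_C, PowerSeries.coeff_succ_mul_X]
      simp [u, pow_succ, PowerSeries.coeff_one]
  have h := det_inv_one_sub_mul (x := fun i => (PowerSeries.C (x i) : PowerSeries R))
    (fun i j h => hx (PowerSeries.C_injective h)) _ hu
  rw [vandermondeProd_mul_left, ← map_vandermondeProd, ← map_vandermondeProd] at h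
  have h2 := congrArg (PowerSeries.coeff (m + ∑ i : Fin n, (n - 1 - (i : ℕ)))) h
  have e : ∀ (A B : R) (s : ℕ) (P : PowerSeries R), PowerSeries.C A *
      (PowerSeries.X ^ s * PowerSeries.C B) * P = PowerSeries.C (A * B) * (P * PowerSeries.X ^ s) := by
    intro A B s P; rw [map_mul]; ring
  rw [e, PowerSeries.coeff_C_mul, PowerSeries.coeff_mul_X_pow, PowerSeries.coeff_prod,
    Matrix.det_apply, map_sum] at h2
  simp only [u, PowerSeries.coeff_mk] at h2
  rw [← h2]
  refine sum_congr rfl fun w _ => ?_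
  rw [Units.smul_def, map_zsmul, PowerSeries.coeff_prod]
  simp

end Cauchy

section FixedColourings

variable {α κ R : Type*} [Fintype α] [DecidableEq α]

theorem sum_filter_prod_quotient [CommSemiring R] [Fintype κ] [DecidableEq κ] (s : Setoid α)
    [DecidableRel s.r] [DecidablePred fun c : α → κ => ∀ a b, s.r a b → c a = c b] (z : κ → R) :
    ∑ c : α → κ with ∀ a b, s.r a b → c a = c b, ∏ a, z (c a) =
      ∏ q : Quotient s, ∑ j, z j ^ #{a | Quotient.mk s a = q} := by
  rw [prod_univ_sum, Fintype.piFinset_univ]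
  symm
  refine sum_bij' (fun d _ a => d (Quotient.mk s a))
    (fun c hc => Quotient.lift c (mem_filter.1 hc).2) ?_ ?_ ?_ ?_ ?_
  · intro d _
    rw [mem_filter]
    exact ⟨mem_univ _, fun a b h => congrArg d (Quotient.sound h)⟩
  · exact fun _ _ => mem_univ _
  · intro d _
    funext q
    exact Quotient.inductionOn q fun a => rfl
  · intro c _
    rfl
  · intro d _
    rw [← prod_fiberwise' univ (fun a => Quotient.mk s a) (fun q => z (d q))]
    simp

namespace Equiv.Perm

instance (g : Perm α) : DecidableRel (SameCycle.setoid g).r :=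
  inferInstanceAs (DecidableRel g.SameCycle)

theorem prod_map_parts_partition {M : Type*} [CommMonoid M] (g : Perm α) (F : ℕ → M) :
    (g.partition.parts.map F).prod =
      ∏ q : Quotient (SameCycle.setoid g), F (#{a | Quotient.mk (SameCycle.setoid g) a = q}) := by
  let cyc : Quotient (SameCycle.setoid g) → Perm α :=
    Quotient.lift g.cycleOf fun _ _ h => SameCycle.cycleOf_eq h
  have hfib : ∀ a, ({b | Quotient.mk (SameCycle.setoid g) b = Quotient.mk _ a} : Finset α) =
      univ.filter fun b => SameCycle g a b := by
    intro a
    ext b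
    simp only [mem_filter, mem_univ, true_and]
    exact ⟨fun h => (Quotient.exact h : SameCycle g b a).symm,
      fun h => Quotient.sound (s := SameCycle.setoid g) h.symm⟩
  rw [parts_partition, Multiset.map_add, Multiset.prod_add, Multiset.map_replicate,
    Multiset.prod_replicate, cycleType_def, Multiset.map_map,
    ← prod_filter_mul_prod_filter_not univ (fun q => cyc q ≠ 1)]
  congr 1
  · change ∏ c ∈ g.cycleFactorsFinset, F #c.support = _
    symm
    refine prod_bij (fun q _ => cyc q) ?_ ?_ ?_ ?_
    · intro q
      refine Quotient.inductionOn q fun a ha => ?_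
      rw [mem_filter] at ha
      exact cycleOf_mem_cycleFactorsFinset_iff.2 (mem_support.2 fun h =>
        ha.2 (cycleOf_eq_one_iff _ |>.2 h))
    · intro q hq q'
      revert hq
      refine Quotient.inductionOn₂ q q' fun a b ha hb hab => ?_
      rw [mem_filter] at ha hb
      have h1 : a ∈ g.support := mem_support.2 fun h => ha.2 (cycleOf_eq_one_iff _ |>.2 h)
      have h2 : a ∈ (g.cycleOf a).support := mem_support_cycleOf_iff.2 ⟨SameCycle.refl _ _, h1⟩
      change g.cycleOf a = g.cycleOf b at hab
      rw [hab] at h2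
      exact Quotient.sound (s := SameCycle.setoid g) (mem_support_cycleOf_iff.1 h2).1.symm
    · intro c hc
      obtain ⟨a, ha⟩ := (mem_cycleFactorsFinset_iff.1 hc).1.nonempty_support
      have e := cycle_is_cycleOf ha hc
      refine ⟨Quotient.mk _ a, mem_filter.2 ⟨mem_univ _, ?_⟩, e.symm⟩
      change g.cycleOf a ≠ 1
      rw [← e]
      exact (mem_cycleFactorsFinset_iff.1 hc).1.ne_one
    · intro q
      refine Quotient.inductionOn q fun a ha => ?_
      rw [mem_filter] at ha
      have h1 : a ∈ g.support := mem_support.2 fun h => ha.2 (cycleOf_eq_one_iff _ |>.2 h)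
      rw [hfib]
      congr 2
      ext b
      change _ ↔ b ∈ (g.cycleOf a).support
      rw [mem_support_cycleOf_iff]
      simp [-mem_support, h1]
  · rw [← card_compl, ← prod_const]
    refine prod_bij (fun a _ => Quotient.mk _ a) ?_ ?_ ?_ ?_
    · intro a ha
      rw [mem_compl, notMem_support] at ha
      simpa [cyc, cycleOf_eq_one_iff] using ha
    · intro a ha b hb hab
      rw [mem_compl, notMem_support] at ha
      have : SameCycle g a b := Quotient.exact hab
      obtain ⟨i, hi⟩ := this
      rw [← hi, zpow_apply_eq_self_of_apply_eq_self ha]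
    · intro q
      refine Quotient.inductionOn q fun a ha => ?_
      have h : g a = a := by simpa [cyc, cycleOf_eq_one_iff] using ha
      exact ⟨a, by simpa using h, rfl⟩
    · intro a ha
      rw [mem_compl, notMem_support] at ha
      rw [hfib]
      have : (univ.filter fun b => SameCycle g a b) = {a} := by
        ext b
        simp only [mem_filter, mem_univ, true_and, mem_singleton]
        refine ⟨?_, fun h => h ▸ SameCycle.refl _ _⟩
        rintro ⟨i, hi⟩
        rw [← hi, zpow_apply_eq_self_of_apply_eq_self ha]
      rw [this, card_singleton]

/-- The power sum of the cycle type of `g` counts the colourings fixed by `g`. -/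
theorem prod_map_parts_partition_sum_pow [CommSemiring R] [Fintype κ] [DecidableEq κ]
    (g : Perm α) (z : κ → R) :
    (g.partition.parts.map fun k => ∑ j, z j ^ k).prod =
      ∑ c : α → κ with c ∘ g = c, ∏ a, z (c a) := by
  rw [prod_map_parts_partition, ← sum_filter_prod_quotient]
  refine sum_congr (filter_congr fun c _ => ?_) fun _ _ => rfl
  constructor
  · intro h
    funext a
    exact (h a (g a) (sameCycle_apply_right.2 (SameCycle.refl _ _))).symm
  · intro h a b hab
    obtain ⟨i, rfl⟩ := hab
    have h' : ∀ a, c (g a) = c a := congrFun h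
    induction i with
    | zero => rfl
    | succ i ih => rw [add_comm, zpow_add, zpow_one, mul_apply, h', ih]
    | pred i ih =>
      rw [← h' ((g ^ (-(i : ℤ) - 1)) a), ← mul_apply, ← zpow_one_add, ih]
      congr 3; ring

end Equiv.Perm

end FixedColourings

section Colourings

variable {α κ R : Type*} [Fintype α] [Fintype κ] [DecidableEq κ]

/-- The number of times each colour is used by a colouring. -/
noncomputable def colouringContent (c : α → κ) : κ →₀ ℕ :=
  Finsupp.equivFunOnFinite.symm fun k => #{a | c a = k}

theorem colouringContent_apply (c : α → κ) (k : κ) : colouringContent c k = #{a | c a = k} := rfl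

theorem prod_colouring [CommMonoid R] (z : κ → R) (c : α → κ) :
    ∏ a, z (c a) = ∏ k, z k ^ colouringContent c k := by
  simp_rw [colouringContent_apply, ← prod_const]
  rw [← prod_fiberwise univ c]
  exact prod_congr rfl fun k _ => prod_congr rfl fun a ha => by rw [(mem_filter.1 ha).2]

theorem colouringContent_mem_finsuppAntidiag (c : α → κ) :
    colouringContent c ∈ finsuppAntidiag univ (Fintype.card α) := by
  rw [mem_finsuppAntidiag]
  refine ⟨?_, subset_univ _⟩
  exact (card_eq_sum_card_fiberwise fun _ _ => mem_univ _).symm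

theorem monomial_colouringContent [CommSemiring R] (c : α → κ) :
    ∏ a, (X (c a) : MvPolynomial κ R) = monomial (colouringContent c) 1 := by
  rw [prod_colouring, monomial_eq, C_1, one_mul, Finsupp.prod_fintype _ _ fun _ => pow_zero _]

theorem card_colouringContent_eq [DecidableEq α] {l : κ →₀ ℕ}
    (hl : l ∈ finsuppAntidiag univ (Fintype.card α)) :
    #{c : α → κ | colouringContent c = l} * ∏ k, (l k).factorial =
      (Fintype.card α).factorial := by
  have hl' : ∑ k, l k = Fintype.card α := (mem_finsuppAntidiag.1 hl).1
  have h := coeff_sum_X_pow_of_fintype (R := ℕ) l (Fintype.card α)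
  rw [Finsupp.sum_fintype _ _ fun _ => rfl, if_pos hl', ← card_univ, ← prod_const,
    prod_univ_sum, Fintype.piFinset_univ, coeff_sum,
    Finsupp.multinomial_eq_of_support_subset (subset_univ _)] at h
  simp_rw [monomial_colouringContent, coeff_monomial] at h
  rw [card_filter, h, mul_comm, Nat.cast_id, Nat.multinomial_spec, hl']

theorem card_filter_comp_eq [DecidableEq α] (c : α → κ) :
    #{g : Perm α | c ∘ g = c} = ∏ k, (colouringContent c k).factorial := by
  rw [← Fintype.card_subtype, DomMulAct.stabilizer_card]
  exact prod_congr rfl fun k _ => by rw [colouringContent_apply, Fintype.card_subtype]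

theorem sum_perm_sum_colouring [DecidableEq α] [CommSemiring R] (z : κ → R) :
    ∑ g : Perm α, ∑ c : α → κ with c ∘ g = c, ∏ a, z (c a) =
      (Fintype.card α).factorial •
        ∑ l ∈ finsuppAntidiag univ (Fintype.card α), ∏ k, z k ^ l k := by
  simp_rw [sum_filter]
  rw [sum_comm, ← sum_fiberwise_of_maps_to
    (fun c _ => colouringContent_mem_finsuppAntidiag (κ := κ) c), smul_sum]
  refine sum_congr rfl fun l hl => ?_
  rw [← card_colouringContent_eq hl, mul_smul, ← sum_const]
  refine sum_congr rfl fun c hc => ?_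
  rw [mem_filter] at hc
  rw [← sum_filter, sum_const, card_filter_comp_eq, prod_colouring z c, hc.2]

end Colourings

section ShiftedPartition

variable {n : ℕ}

namespace Nat.Partition

/-- The `i`-th largest part of a partition, or `0` if there are at most `i` parts. -/
def row (ρ : n.Partition) (i : ℕ) : ℕ :=
  (ρ.parts.sort (· ≤ ·)).reverse.getD i 0

/-- The exponent vector `ρ + δ` with `δ = (n - 1, …, 1, 0)`. -/
noncomputable def shifted (ρ : n.Partition) : Fin n →₀ ℕ :=
  Finsupp.equivFunOnFinite.symm fun i : Fin n => ρ.row i + (n - 1 - (i : ℕ))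

theorem shifted_apply (ρ : n.Partition) (i : Fin n) :
    ρ.shifted i = ρ.row i + (n - 1 - (i : ℕ)) := rfl

theorem card_parts_le (ρ : n.Partition) : Multiset.card ρ.parts ≤ n := by
  conv_rhs => rw [← ρ.parts_sum]
  simpa using Multiset.card_nsmul_le_sum (s := ρ.parts) (a := 1) fun _ h => ρ.parts_pos h

theorem map_row (ρ : n.Partition) :
    Multiset.map (fun i : Fin n => ρ.row i) univ.val =
      ρ.parts + Multiset.replicate (n - Multiset.card ρ.parts) 0 := by
  set L := (ρ.parts.sort (· ≤ ·)).reverse with hL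
  have hLp : (L : Multiset ℕ) = ρ.parts := by
    rw [hL, Multiset.coe_reverse, Multiset.sort_eq]
  have hlen : L.length = Multiset.card ρ.parts := by rw [← hLp, Multiset.coe_card]
  have h : (List.ofFn fun i : Fin n => ρ.row i) =
      L ++ List.replicate (n - Multiset.card ρ.parts) 0 := by
    refine List.ext_getElem ?_ fun i h1 h2 => ?_
    · have := ρ.card_parts_le
      simp only [List.length_ofFn, List.length_append, List.length_replicate]
      omega
    · rw [List.getElem_ofFn, List.getElem_append]
      split_ifs with hi
      · exact List.getD_eq_getElem _ _ hi
      · rw [List.getElem_replicate]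
        exact List.getD_eq_default _ _ (not_lt.1 hi)
  rw [Fin.univ_val_map, h, ← hLp, ← Multiset.coe_add, Multiset.coe_replicate]

theorem sum_shifted (ρ : n.Partition) :
    ∑ i, ρ.shifted i = n + ∑ i : Fin n, (n - 1 - (i : ℕ)) := by
  simp_rw [shifted_apply, sum_add_distrib]
  congr 1
  rw [Finset.sum, map_row, Multiset.sum_add, ρ.parts_sum]
  simp

theorem shifted_injective : Function.Injective (shifted (n := n)) := by
  intro ρ σ h
  have h1 : (fun i : Fin n => ρ.row i) = fun i : Fin n => σ.row i := by
    funext i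
    simpa [shifted_apply] using DFunLike.congr_fun h i
  have h2 := congrArg (fun f => (Multiset.map f univ.val).filter (· ≠ 0)) h1
  have h3 : ∀ τ : n.Partition, τ.parts.filter (· ≠ 0) = τ.parts := fun τ =>
    Multiset.filter_eq_self.2 fun _ h => (τ.parts_pos h).ne'
  have h4 : ∀ k : ℕ, (Multiset.replicate k 0).filter (· ≠ 0) = 0 := fun k =>
    Multiset.filter_eq_nil.2 fun a h => by simp [Multiset.eq_of_mem_replicate h]
  simp only [map_row, Multiset.filter_add, h3, h4, add_zero] at h2
  exact Nat.Partition.ext h2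

theorem row_antitone (ρ : n.Partition) : Antitone ρ.row := by
  intro i j hij
  have hs : (ρ.parts.sort (· ≤ ·)).reverse.Pairwise (· ≥ ·) :=
    List.pairwise_reverse.2 (Multiset.pairwise_sort _ _)
  rw [row, row]
  by_cases hj : j < (ρ.parts.sort (· ≤ ·)).reverse.length
  · rw [List.getD_eq_getElem _ _ hj, List.getD_eq_getElem _ _ (hij.trans_lt hj)]
    exact hs.rel_get_of_le (a := ⟨i, hij.trans_lt hj⟩) (b := ⟨j, hj⟩) hij
  · rw [List.getD_eq_default _ _ (not_lt.1 hj)]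
    exact Nat.zero_le _

theorem shifted_strictAnti (ρ : n.Partition) : StrictAnti ρ.shifted := by
  intro i j hij
  have h : ρ.row j ≤ ρ.row i := ρ.row_antitone (Fin.lt_def.1 hij).le
  have hij := Fin.lt_def.1 hij
  have hj := j.2
  rw [shifted_apply, shifted_apply]
  omega

theorem shifted_comp_perm_eq_iff {ρ σ : n.Partition} {w : Perm (Fin n)} :
    (∀ i, σ.shifted (w i) = ρ.shifted i) ↔ w = 1 ∧ σ = ρ := by
  refine ⟨fun h => ?_, fun ⟨h1, h2⟩ => by subst h1 h2; simp⟩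
  have hw : StrictMono w := by
    intro i j hij
    rw [← σ.shifted_strictAnti.lt_iff_gt, h, h]
    exact ρ.shifted_strictAnti hij
  have hw1 : w = 1 := by
    ext1 i
    exact DFunLike.congr_fun (Subsingleton.elim (hw.orderIsoOfSurjective w w.surjective)
      (OrderIso.refl _)) i
  subst hw1
  exact ⟨rfl, shifted_injective (Finsupp.ext h)⟩

end Nat.Partition

end ShiftedPartition

section Orthogonality

variable {n : ℕ}

/-- The symmetric polynomial with value `p_μ` at the cycle type `μ` of a permutation. -/
noncomputable def permPowerSum {R : Type*} [CommSemiring R] (x : Fin n → R)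
    (g : Perm (Fin n)) : R :=
  (g.partition.parts.map fun k => ∑ j, x j ^ k).prod

/-- The class function `charSn n ρ` on permutations. -/
noncomputable def charPerm (ρ : n.Partition) (g : Perm (Fin n)) : ℤ :=
  coeff ρ.shifted (vandermondeProd X * permPowerSum X g)

theorem charPerm_eq_charSn {g : Perm (Fin n)} {mu : n.Partition} (h : hasCycleType g mu)
    (ρ : n.Partition) : charPerm ρ g = charSn n ρ mu := by
  rw [charPerm, permPowerSum, h]
  rfl

theorem map_permPowerSum {R S : Type*} [CommSemiring R] [CommSemiring S] (f : R →+* S)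
    (x : Fin n → R) (g : Perm (Fin n)) :
    f (permPowerSum x g) = permPowerSum (fun i => f (x i)) g := by
  rw [permPowerSum, permPowerSum, map_multiset_prod, Multiset.map_map]
  simp

theorem permPowerSum_mul {R : Type*} [CommSemiring R] (x y : Fin n → R) (g : Perm (Fin n)) :
    permPowerSum x g * permPowerSum y g =
      (g.partition.parts.map fun k => ∑ p : Fin n × Fin n, (x p.1 * y p.2) ^ k).prod := by
  rw [permPowerSum, permPowerSum, ← Multiset.prod_map_mul]
  congr 2
  funext k
  simp_rw [sum_mul_sum, Fintype.sum_prod_type, mul_pow]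

theorem coeff_coeff_map_mul_C {σ τ R : Type*} [CommSemiring R] (p : MvPolynomial σ R)
    (q : MvPolynomial τ R) (a : σ →₀ ℕ) (b : τ →₀ ℕ) :
    coeff b (coeff a (map C p * C q)) = coeff a p * coeff b q := by
  rw [mul_comm, coeff_C_mul, coeff_map, mul_comm, coeff_C_mul]

theorem sum_vandermondeProd_mul_permPowerSum {R : Type*} [CommRing R] [IsDomain R]
    {x : Fin n → R} (hx : Function.Injective x) (y : Fin n → R) :
    ∑ g : Perm (Fin n),
        (vandermondeProd x * permPowerSum x g) * (vandermondeProd y * permPowerSum y g) =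
      n.factorial • ∑ w : Perm (Fin n), (Perm.sign w : ℤ) •
        ∑ l ∈ finsuppAntidiag (univ : Finset (Fin n)) (n + ∑ i : Fin n, (n - 1 - (i : ℕ))),
          ∏ i, (x (w i) * y i) ^ l i := by
  have h := sum_perm_sum_colouring (α := Fin n) fun p : Fin n × Fin n => x p.1 * y p.2
  rw [Fintype.card_fin] at h
  rw [← cauchy_identity hx, ← mul_smul_comm, ← h, mul_sum]
  refine sum_congr rfl fun g _ => ?_
  rw [← Equiv.Perm.prod_map_parts_partition_sum_pow g fun p : Fin n × Fin n => x p.1 * y p.2,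
    ← permPowerSum_mul]
  ring

theorem sum_charPerm_mul_charPerm (ρ σ : n.Partition) :
    ∑ g : Perm (Fin n), charPerm ρ g * charPerm σ g = if ρ = σ then (n.factorial : ℤ) else 0 := by
  let x : Fin n → MvPolynomial (Fin n) (MvPolynomial (Fin n) ℤ) := X
  let y : Fin n → MvPolynomial (Fin n) (MvPolynomial (Fin n) ℤ) := fun i => C (X i)
  have h := congrArg (fun F => coeff σ.shifted (coeff ρ.shifted F))
    (sum_vandermondeProd_mul_permPowerSum (x := x) (X_injective) y)
  have h1 : ∀ g, charPerm ρ g * charPerm σ g = coeff σ.shifted (coeff ρ.shifted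
      ((vandermondeProd x * permPowerSum x g) * (vandermondeProd y * permPowerSum y g))) := by
    intro g
    rw [charPerm, charPerm, ← coeff_coeff_map_mul_C]
    simp only [map_mul, map_vandermondeProd, map_permPowerSum, map_X, x, y]
  have h2 : ∀ (w : Perm (Fin n)) (l : Fin n →₀ ℕ),
      coeff σ.shifted (coeff ρ.shifted (∏ i, (x (w i) * y i) ^ l i)) =
        if l = σ.shifted ∧ ∀ i, l (w.symm i) = ρ.shifted i then 1 else 0 := by
    intro w l
    have e : ∏ i, (x (w i) * y i) ^ l i =
        map C (monomial (l.equivMapDomain w) (1 : ℤ)) * C (monomial l 1) := by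
      rw [monomial_eq, monomial_eq, Finsupp.prod_fintype _ _ fun _ => pow_zero _,
        Finsupp.prod_fintype _ _ fun _ => pow_zero _]
      simp_rw [mul_pow, prod_mul_distrib]
      rw [← Equiv.prod_comp w.symm fun i => x (w i) ^ l i]
      simp [x, y]
    rw [e, coeff_coeff_map_mul_C, coeff_monomial, coeff_monomial, mul_comm, ite_zero_mul_ite_zero,
      mul_one]
    exact if_congr (and_congr_right fun _ => DFunLike.ext_iff) rfl rfl
  have h3 : ∀ w : Perm (Fin n), coeff σ.shifted (coeff ρ.shifted
      (∑ l ∈ finsuppAntidiag univ (n + ∑ i : Fin n, (n - 1 - (i : ℕ))),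
        ∏ i, (x (w i) * y i) ^ l i)) = if w = 1 ∧ ρ = σ then 1 else 0 := by
    intro w
    rw [coeff_sum, coeff_sum, sum_congr rfl fun l _ => h2 w l, sum_eq_single σ.shifted]
    · refine if_congr ?_ rfl rfl
      rw [and_iff_right rfl, ← Equiv.Perm.inv_def, Nat.Partition.shifted_comp_perm_eq_iff,
        inv_eq_one, eq_comm (a := σ)]
    · exact fun l _ hl => if_neg fun h => hl h.1
    · exact fun h => absurd (mem_finsuppAntidiag.2 ⟨σ.sum_shifted, subset_univ _⟩) h
  simp_rw [h1, ← coeff_sum, h]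
  rw [coeff_smul, coeff_smul, coeff_sum, coeff_sum, sum_congr rfl fun w _ => by
    rw [coeff_smul, coeff_smul, h3 w], sum_eq_single 1 (fun w _ hw => by simp [hw]) (by simp)]
  simp

end Orthogonality

section ColouringRepresentation

variable {α κ : Type*} [Fintype α] [Fintype κ] [DecidableEq κ]

theorem colouringContent_comp_perm (c : α → κ) (g : Perm α) :
    colouringContent (c ∘ g) = colouringContent c := by
  ext k
  rw [colouringContent_apply, colouringContent_apply]
  exact card_equiv g (by simp)

/-- The permutation representation on colourings with a given content. -/
noncomputable def colouringRepresentation (l : κ →₀ ℕ) :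
    Representation ℂ (Perm α) ({c : α → κ // colouringContent c = l} → ℂ) where
  toFun g := LinearMap.funLeft ℂ ℂ fun c =>
    ⟨c.1 ∘ g, (colouringContent_comp_perm c.1 g).trans c.2⟩
  map_one' := rfl
  map_mul' _ _ := rfl

theorem trace_funLeft {ι K : Type*} [Fintype ι] [DecidableEq ι] [CommRing K] (f : ι → ι) :
    LinearMap.trace K (ι → K) (LinearMap.funLeft K K f) = #{i | f i = i} := by
  rw [LinearMap.trace_eq_matrix_trace K (Pi.basisFun K ι), Matrix.trace, card_filter,
    Nat.cast_sum]
  refine sum_congr rfl fun i _ => ?_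
  simp [LinearMap.funLeft_apply, Pi.single_apply]

theorem colouringRepresentation_character [DecidableEq α] (l : κ →₀ ℕ) (g : Perm α) :
    (colouringRepresentation l).character g =
      (#{c : α → κ | c ∘ g = c ∧ colouringContent c = l} : ℂ) := by
  refine (trace_funLeft _).trans ?_
  congr 1
  refine card_bij (fun c _ => c.1) ?_ (fun _ _ _ _ h => Subtype.ext h) ?_
  · intro c hc
    simp only [mem_filter, mem_univ, true_and] at hc ⊢
    exact ⟨congrArg Subtype.val hc, c.2⟩
  · intro c hc
    simp only [mem_filter, mem_univ, true_and] at hc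
    exact ⟨⟨c, hc.2⟩, by simpa using hc.1, rfl⟩

end ColouringRepresentation

section IrreducibleCharacters

variable {n : ℕ}

theorem coeff_permPowerSum {R : Type*} [CommSemiring R] (l : Fin n →₀ ℕ) (g : Perm (Fin n)) :
    coeff l (permPowerSum (X : Fin n → MvPolynomial (Fin n) R) g) =
      (#{c : Fin n → Fin n | c ∘ g = c ∧ colouringContent c = l} : R) := by
  rw [permPowerSum, Equiv.Perm.prod_map_parts_partition_sum_pow, coeff_sum, ← filter_filter,
    card_filter, Nat.cast_sum]
  simp_rw [monomial_colouringContent, coeff_monomial]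
  simp

theorem charPerm_mem_span (ρ : n.Partition) :
    (fun g => (charPerm ρ g : ℂ)) ∈
      Submodule.span ℤ {χ : Perm (Fin n) → ℂ | IsIrredChar χ} := by
  have h : (fun g => (charPerm ρ g : ℂ)) = ∑ p ∈ antidiagonal ρ.shifted,
      coeff p.1 (vandermondeProd (X : Fin n → MvPolynomial (Fin n) ℤ)) •
        (colouringRepresentation (α := Fin n) p.2).character := by
    funext g
    rw [charPerm, coeff_mul, Int.cast_sum, Finset.sum_apply]
    refine sum_congr rfl fun p _ => ?_
    rw [Pi.smul_apply, colouringRepresentation_character, coeff_permPowerSum, zsmul_eq_mul]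
    push_cast
    rfl
  rw [h]
  exact Submodule.sum_mem _ fun p _ => Submodule.smul_mem _ _
    (Representation.character_mem_span_isIrredChar _ _ _ rfl)

theorem charPerm_congr {g h : Perm (Fin n)} (e : g.partition.parts = h.partition.parts)
    (ρ : n.Partition) : charPerm ρ g = charPerm ρ h := by
  rw [charPerm, charPerm, permPowerSum, permPowerSum, e]

theorem isIrredChar_charPerm (ρ : n.Partition) :
    IsIrredChar (fun g => (charPerm ρ g : ℂ)) ∨ IsIrredChar (-fun g => (charPerm ρ g : ℂ)) := by
  refine isIrredChar_or_neg_of_mem_span (charPerm_mem_span ρ) ?_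
  have h := congrArg (Int.cast (R := ℂ)) (sum_charPerm_mul_charPerm ρ ρ)
  rw [if_pos rfl] at h
  rw [Nat.card_eq_fintype_card, Fintype.card_perm, Fintype.card_fin]
  push_cast at h
  rw [← h]
  refine sum_congr rfl fun g _ => ?_
  rw [charPerm_congr (g := g⁻¹) (h := g)]
  rw [Perm.parts_partition, Perm.parts_partition, Perm.cycleType_inv, Perm.support_inv]

theorem charPerm_one_ne_zero (ρ : n.Partition) : charPerm ρ 1 ≠ 0 := by
  rcases isIrredChar_charPerm ρ with h | h <;> simpa using h.apply_one_ne_zero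

theorem hasCycleType_conj {g h : Perm (Fin n)} {mu : n.Partition} :
    hasCycleType (h * g * h⁻¹) mu ↔ hasCycleType g mu := by
  rw [hasCycleType, hasCycleType, ← Perm.partition_eq_of_isConj.1 (isConj_iff.2 ⟨h, rfl⟩)]

theorem sum_mul_sum_charPerm (ρ : n.Partition) {a b : Perm (Fin n) → ℤ}
    (ha : ∀ g h, a (h * g * h⁻¹) = a g) (hb : ∀ g h, b (h * g * h⁻¹) = b g) :
    (∑ g, a g * charPerm ρ g) * (∑ g, b g * charPerm ρ g) =
      charPerm ρ 1 * ∑ g, ∑ h, a g * b h * charPerm ρ (g * h) := by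
  have ha' : ∀ g h, (a (h * g * h⁻¹) : ℂ) = a g := fun g h => by rw [ha]
  have hb' : ∀ g h, (b (h * g * h⁻¹) : ℂ) = b g := fun g h => by rw [hb]
  apply Int.cast_injective (α := ℂ)
  push_cast
  rcases isIrredChar_charPerm ρ with h | h
  · exact h.sum_mul_sum ha' hb'
  · simpa using h.sum_mul_sum ha' hb'

end IrreducibleCharacters

section CycleTypeClasses

variable {n : ℕ}

open Classical in
/-- The permutations of cycle type `lam`. -/
noncomputable def cycleClass (lam : n.Partition) : Finset (Perm (Fin n)) :=
  univ.filter fun g => hasCycleType g lam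

theorem mem_cycleClass {lam : n.Partition} {g : Perm (Fin n)} :
    g ∈ cycleClass lam ↔ hasCycleType g lam := by
  simp [cycleClass]

/-- The cycle type of a permutation of `Fin n`, as a partition of `n`. -/
def cyclePartition (g : Perm (Fin n)) : n.Partition where
  parts := g.partition.parts
  parts_pos := g.partition.parts_pos
  parts_sum := g.partition.parts_sum.trans (Fintype.card_fin n)

theorem hasCycleType_iff {lam : n.Partition} {g : Perm (Fin n)} :
    hasCycleType g lam ↔ cyclePartition g = lam :=
  (Nat.Partition.ext_iff (x := cyclePartition g)).symm

theorem Nat.Partition.filter_parts_add (lam : n.Partition) :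
    lam.parts.filter (2 ≤ ·) + Multiset.replicate (lam.parts.count 1) 1 = lam.parts := by
  rw [← Multiset.filter_eq', Multiset.filter_add_filter]
  have h1 : lam.parts.filter (fun k => 2 ≤ k ∨ k = 1) = lam.parts :=
    Multiset.filter_eq_self.2 fun k hk => by have := lam.parts_pos hk; omega
  have h2 : lam.parts.filter (fun k => 2 ≤ k ∧ k = 1) = 0 :=
    Multiset.filter_eq_nil.2 fun k _ => by omega
  rw [h1, h2, add_zero]

theorem Nat.Partition.count_one (lam : n.Partition) :
    lam.parts.count 1 = n - (lam.parts.filter (2 ≤ ·)).sum := by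
  have h := congrArg Multiset.sum lam.filter_parts_add
  rw [Multiset.sum_add, lam.parts_sum, Multiset.sum_replicate, smul_eq_mul, mul_one] at h
  omega

theorem hasCycleType_iff_cycleType {lam : n.Partition} {g : Perm (Fin n)} :
    hasCycleType g lam ↔ g.cycleType = lam.parts.filter (2 ≤ ·) := by
  refine ⟨fun h => ?_, fun h => ?_⟩
  · rw [← Perm.filter_parts_partition_eq_cycleType, h]
  · rw [hasCycleType, Perm.parts_partition, ← Perm.sum_cycleType, h, Fintype.card_fin,
      ← Nat.Partition.count_one, Nat.Partition.filter_parts_add]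

theorem zPart_eq (hn : 0 < n) (lam : n.Partition) :
    zPart lam = (n - (lam.parts.filter (2 ≤ ·)).sum).factorial *
      (lam.parts.filter (2 ≤ ·)).prod *
        ∏ k ∈ (lam.parts.filter (2 ≤ ·)).toFinset,
          ((lam.parts.filter (2 ≤ ·)).count k).factorial := by
  have hle : ∀ k ∈ lam.parts, k < n + 1 := fun k hk =>
    Nat.lt_succ_of_le (lam.parts_sum ▸ Multiset.le_sum_of_mem hk)
  have h1 : ∏ k ∈ range (n + 1), k ^ lam.parts.count k = (lam.parts.filter (2 ≤ ·)).prod := by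
    rw [← prod_multiset_count_of_subset _ _ fun k hk => mem_range.2
      (hle k (Multiset.mem_toFinset.1 hk))]
    conv_lhs => rw [← lam.filter_parts_add]
    simp
  have h2 : ∏ k ∈ range (n + 1), (lam.parts.count k).factorial =
      (lam.parts.count 1).factorial * ∏ k ∈ (lam.parts.filter (2 ≤ ·)).toFinset,
          ((lam.parts.filter (2 ≤ ·)).count k).factorial := by
    rw [prod_congr (s₂ := (lam.parts.filter (2 ≤ ·)).toFinset) rfl (g := fun k =>
      (lam.parts.count k).factorial) fun k hk => by
        rw [Multiset.count_filter_of_pos (Multiset.mem_filter.1 (Multiset.mem_toFinset.1 hk)).2],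
      ← prod_insert (f := fun k => (lam.parts.count k).factorial)
        (s := (lam.parts.filter (2 ≤ ·)).toFinset) (a := 1) (by simp)]
    symm
    refine prod_subset ?_ ?_
    · intro k hk
      rw [mem_insert, Multiset.mem_toFinset, Multiset.mem_filter] at hk
      rw [mem_range]
      rcases hk with rfl | hk
      · omega
      · exact hle k hk.1
    · intro k _ hk
      rw [mem_insert, Multiset.mem_toFinset, Multiset.mem_filter] at hk
      rw [Multiset.count_eq_zero_of_notMem, Nat.factorial_zero]
      intro h
      have := lam.parts_pos h
      exact hk (by by_cases k = 1 <;> [left; (right; refine ⟨h, ?_⟩)] <;> omega)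
  rw [zPart, prod_mul_distrib, h1, h2, Nat.Partition.count_one]
  ring

theorem card_cycleClass_mul_zPart (hn : 0 < n) (lam : n.Partition) :
    #(cycleClass lam) * zPart lam = n.factorial := by
  have h := Perm.card_of_cycleType_mul_eq (Fin n) (lam.parts.filter (2 ≤ ·))
  rw [if_pos, Fintype.card_fin, ← zPart_eq hn] at h
  · rw [← h]
    congr 2
    ext g
    simp [mem_cycleClass, hasCycleType_iff_cycleType]
  · refine ⟨?_, fun k hk => (Multiset.mem_filter.1 hk).2⟩
    have h := congrArg Multiset.sum lam.filter_parts_add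
    rw [Multiset.sum_add, lam.parts_sum] at h
    rw [Fintype.card_fin]
    omega

theorem sum_cycleClass {M : Type*} [AddCommMonoid M] (f : Perm (Fin n) → M) :
    ∑ g, f g = ∑ mu : n.Partition, ∑ g ∈ cycleClass mu, f g := by
  classical
  rw [← sum_fiberwise univ cyclePartition f]
  refine sum_congr rfl fun mu _ => sum_congr ?_ fun _ _ => rfl
  ext g
  simp [mem_cycleClass, hasCycleType_iff]

theorem sum_charSn_mul_charSn (mu nu : n.Partition) :
    (#(cycleClass mu) : ℚ) * ∑ ρ, (charSn n ρ mu : ℚ) * charSn n ρ nu =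
      if mu = nu then (n.factorial : ℚ) else 0 := by
  have hn : (n.factorial : ℚ) ≠ 0 := Nat.cast_ne_zero.2 n.factorial_ne_zero
  let M : Matrix n.Partition n.Partition ℚ := .of fun ρ mu => charSn n ρ mu
  let N : Matrix n.Partition n.Partition ℚ := .of fun mu ρ =>
    #(cycleClass mu) * charSn n ρ mu / n.factorial
  have h : M * N = 1 := by
    ext ρ σ
    have h := congrArg (Int.cast (R := ℚ)) (sum_charPerm_mul_charPerm ρ σ)
    rw [sum_cycleClass] at h
    rw [Matrix.mul_apply, Matrix.one_apply]
    have e : ∀ mu, M ρ mu * N mu σ =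
        ((∑ g ∈ cycleClass mu, charPerm ρ g * charPerm σ g : ℤ) : ℚ) / n.factorial := by
      intro mu
      rw [sum_congr rfl fun g hg => by rw [charPerm_eq_charSn (mem_cycleClass.1 hg),
        charPerm_eq_charSn (mem_cycleClass.1 hg)], sum_const]
      simp only [M, N, Matrix.of_apply, nsmul_eq_mul]
      push_cast
      ring
    rw [sum_congr rfl fun mu _ => e mu, ← sum_div, ← Int.cast_sum, h]
    split_ifs <;> simp [hn]
  have h' := congrArg (fun A : Matrix n.Partition n.Partition ℚ => A mu nu) (mul_eq_one_comm.1 h)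
  simp only [Matrix.mul_apply, Matrix.one_apply] at h'
  rw [← div_left_inj' hn, mul_sum, sum_div]
  refine (sum_congr rfl fun ρ _ => ?_).trans (h'.trans ?_)
  · simp only [M, N, Matrix.of_apply]
    ring
  · split_ifs <;> simp [hn]

theorem numFactorizations_eq_card (lam mu : n.Partition) (σ : Perm (Fin n)) :
    numFactorizations n lam mu σ =
      #((cycleClass lam ×ˢ cycleClass mu).filter fun p => p.1 * p.2 = σ) := by
  classical
  rw [numFactorizations, Nat.card_eq_fintype_card, Fintype.card_subtype]
  congr 1
  ext p
  simp [mem_cycleClass, and_assoc]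

theorem numFactorizations_conj (lam mu : n.Partition) (σ τ : Perm (Fin n)) :
    numFactorizations n lam mu (τ * σ * τ⁻¹) = numFactorizations n lam mu σ := by
  refine (Nat.card_congr (Equiv.subtypeEquiv
    ((MulAut.conj τ).toEquiv.prodCongr (MulAut.conj τ).toEquiv) fun p => ?_)).symm
  simp only [Equiv.prodCongr_apply, Prod.map_fst, Prod.map_snd, MulEquiv.toEquiv_eq_coe,
    MulEquiv.coe_toEquiv, MulAut.conj_apply, hasCycleType_conj]
  refine and_congr_right fun _ => and_congr_right fun _ => ?_
  rw [← MulAut.conj_apply, ← MulAut.conj_apply, ← MulAut.conj_apply, ← map_mul,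
    EmbeddingLike.apply_eq_iff_eq]

theorem numFactorizations_congr (lam mu : n.Partition) {nu : n.Partition}
    {σ τ : Perm (Fin n)} (hσ : hasCycleType σ nu) (hτ : hasCycleType τ nu) :
    numFactorizations n lam mu τ = numFactorizations n lam mu σ := by
  obtain ⟨k, rfl⟩ := isConj_iff.1 (Perm.partition_eq_of_isConj.2
    (Nat.Partition.ext (hσ.trans hτ.symm)))
  exact numFactorizations_conj lam mu σ k

theorem sum_cycleClass_mul_sum_cycleClass (ρ lam mu : n.Partition) :
    (#(cycleClass lam) * charSn n ρ lam) * (#(cycleClass mu) * charSn n ρ mu) =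
      charSn n ρ (onesPartition n) *
        ∑ g ∈ cycleClass lam, ∑ h ∈ cycleClass mu, charPerm ρ (g * h) := by
  classical
  have hind : ∀ nu : n.Partition, ∀ g h : Perm (Fin n),
      (if h * g * h⁻¹ ∈ cycleClass nu then (1 : ℤ) else 0) = if g ∈ cycleClass nu then 1 else 0 := by
    intro nu g h
    simp only [mem_cycleClass, hasCycleType_conj]
  have hone : charPerm ρ (1 : Perm (Fin n)) = charSn n ρ (onesPartition n) :=
    charPerm_eq_charSn (by simp [hasCycleType, onesPartition, Perm.parts_partition]) ρ
  have hsum : ∀ nu : n.Partition,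
      ∑ g, (if g ∈ cycleClass nu then (1 : ℤ) else 0) * charPerm ρ g =
        #(cycleClass nu) * charSn n ρ nu := by
    intro nu
    simp only [ite_mul, one_mul, zero_mul, sum_ite_mem, univ_inter]
    rw [sum_congr rfl fun g hg => charPerm_eq_charSn (mem_cycleClass.1 hg) ρ, sum_const,
      nsmul_eq_mul]
  have h := sum_mul_sum_charPerm ρ (a := fun g => if g ∈ cycleClass lam then 1 else 0)
    (b := fun g => if g ∈ cycleClass mu then 1 else 0) (hind lam) (hind mu)
  rw [hsum, hsum, hone] at h
  rw [h]
  simp [sum_ite_mem]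

end CycleTypeClasses

/-- the class algebra / character formula for the number of
factorizations. -/
theorem numFactorizations_eq_char_sum (n : ℕ) (hn : 0 < n)
    (lam mu nu : n.Partition) (σ : Equiv.Perm (Fin n)) (hσ : hasCycleType σ nu) :
    (numFactorizations n lam mu σ : ℚ) =
      (n.factorial : ℚ) / ((zPart lam : ℚ) * (zPart mu : ℚ)) *
        ∑ ρ : n.Partition,
          ((charSn n ρ lam : ℚ) * (charSn n ρ mu : ℚ) * (charSn n ρ nu : ℚ)) /
            (charSn n ρ (onesPartition n) : ℚ) := by
  classical
  have hfac : (n.factorial : ℚ) ≠ 0 := Nat.cast_ne_zero.2 n.factorial_ne_zero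
  have hcard : ∀ κ : n.Partition, (#(cycleClass κ) : ℚ) * zPart κ = n.factorial := fun κ =>
    mod_cast card_cycleClass_mul_zPart hn κ
  have hz : ∀ κ : n.Partition, (zPart κ : ℚ) ≠ 0 := fun κ h => hfac (by rw [← hcard κ, h, mul_zero])
  have hnu : (#(cycleClass nu) : ℚ) ≠ 0 := fun h => hfac (by rw [← hcard nu, h, zero_mul])
  have hone : ∀ ρ : n.Partition, (charSn n ρ (onesPartition n) : ℚ) ≠ 0 := fun ρ => by
    rw [← charPerm_eq_charSn (g := 1)
      (by simp [hasCycleType, onesPartition, Perm.parts_partition]) ρ]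
    exact Int.cast_ne_zero.2 (charPerm_one_ne_zero ρ)
  have hprod : ∀ ρ : n.Partition,
      ((charSn n ρ lam : ℚ) * charSn n ρ mu * charSn n ρ nu) / charSn n ρ (onesPartition n) =
        (zPart lam * zPart mu / (n.factorial * n.factorial)) *
          ∑ g ∈ cycleClass lam, ∑ h ∈ cycleClass mu,
            (charSn n ρ nu : ℚ) * charSn n ρ (cyclePartition (g * h)) := by
    intro ρ
    have h := congrArg (Int.cast (R := ℚ)) (sum_cycleClass_mul_sum_cycleClass ρ lam mu)
    push_cast at h
    simp_rw [fun g => charPerm_eq_charSn (hasCycleType_iff.2 (rfl : cyclePartition g = _)) ρ] at h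
    simp_rw [← mul_sum]
    rw [div_eq_iff (hone ρ), div_mul_eq_mul_div, div_mul_eq_mul_div,
      eq_div_iff (mul_ne_zero hfac hfac)]
    linear_combination
      (charSn n ρ nu * zPart lam * zPart mu : ℚ) * h -
      (charSn n ρ lam * charSn n ρ mu * charSn n ρ nu : ℚ) * n.factorial * hcard lam -
      (charSn n ρ lam * charSn n ρ mu * charSn n ρ nu : ℚ) *
        (#(cycleClass lam) * zPart lam) * hcard mu
  have hcol : ∀ g h : Perm (Fin n),
      ∑ ρ, (charSn n ρ nu : ℚ) * charSn n ρ (cyclePartition (g * h)) =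
        if g * h ∈ cycleClass nu then (n.factorial : ℚ) / #(cycleClass nu) else 0 := by
    intro g h
    have e := sum_charSn_mul_charSn nu (cyclePartition (g * h))
    simp only [mem_cycleClass, hasCycleType_iff, eq_comm (b := nu)]
    rw [mul_comm, ← eq_div_iff hnu] at e
    rw [e]
    split_ifs <;> simp
  have hcount : ∑ g ∈ cycleClass lam, ∑ h ∈ cycleClass mu,
      (if g * h ∈ cycleClass nu then (1 : ℚ) else 0) =
        #(cycleClass nu) * numFactorizations n lam mu σ := by
    rw [← sum_product', ← Finset.sum_filter, sum_const, nsmul_eq_mul, mul_one]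
    have hmaps : Set.MapsTo (fun p : Perm (Fin n) × Perm (Fin n) => p.1 * p.2)
        ((cycleClass lam ×ˢ cycleClass mu).filter fun p => p.1 * p.2 ∈ cycleClass nu)
        (cycleClass nu) := fun p hp => (mem_filter.1 (mem_coe.1 hp)).2
    rw [card_eq_sum_card_fiberwise hmaps,
      sum_congr rfl (g := fun _ => numFactorizations n lam mu σ)]
    · simp
    · intro τ hτ
      rw [← numFactorizations_congr lam mu hσ (mem_cycleClass.1 hτ), numFactorizations_eq_card,
        filter_filter]
      congr 1
      refine filter_congr fun p _ => ⟨And.right, fun h => ⟨h ▸ hτ, h⟩⟩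
  have hif : ∀ g h : Perm (Fin n),
      (if g * h ∈ cycleClass nu then (n.factorial : ℚ) / #(cycleClass nu) else 0) =
        (n.factorial : ℚ) / #(cycleClass nu) * if g * h ∈ cycleClass nu then 1 else 0 := by
    intro g h
    split_ifs <;> simp
  rw [sum_congr rfl fun ρ _ => hprod ρ, ← mul_sum, sum_comm]
  simp_rw [sum_comm (s := univ (α := n.Partition)), hcol, hif, ← mul_sum]
  rw [hcount]
  have := hz lam
  have := hz mu
  field_simp
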